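/- Fix n ≥ 2 and k ∈ (0,1). Define ψ_SC : (0,∞)ⁿ → (0,∞) by ψ_SC(y) = (y_(n)/(1+k)) · exp{1/n − (ln b_*(y))/(b_*(y)^n − 1)}, where b_*(y) = (y_(1)/(1−k))/(y_(n)/(1+k)). Then ψ_SC is scale equivariant and uniformly minimizes the squared logarithmic risk in the class of scale-equivariant estimators: for every measurable ψ : (0,∞)ⁿ → (0,∞) with ψ(cy) = c·ψ(y) for all c > 0 and all y, and for every θ > 0, E[(ln θ − ln ψ_SC(Y))²] ≤ E[(ln θ − ln ψ(Y))²], where Y = (Y_1,…,Y_n) with Y_i i.i.d. uniform on [θ(1−k), θ(1+k)]. -/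

import Mathlib

open MeasureTheory

/-- The uniform probability distribution on the interval `[a, b]`. -/
noncomputable def unifIcc (a b : ℝ) : Measure ℝ :=
  (ENNReal.ofReal (b - a))⁻¹ • volume.restrict (Set.Icc a b)

/-- The estimator `θ̂_SC`:
`ψ_SC(y) = (y_(n)/(1+k)) exp{1/n - ln b_*(y)/(b_*(y)^n - 1)}` with
`b_*(y) = (y_(1)/(1-k))/(y_(n)/(1+k))`. -/
noncomputable def psiSC (n : ℕ) (k : ℝ) (y : Fin n → ℝ) : ℝ :=
  ((⨆ i, y i) / (1 + k)) *
    Real.exp (1 / n -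
      Real.log (((⨅ i, y i) / (1 - k)) / ((⨆ i, y i) / (1 + k)))
        / ((((⨅ i, y i) / (1 - k)) / ((⨆ i, y i) / (1 + k))) ^ n - 1))

theorem pi_unifIcc (n : ℕ) (a b : ℝ) (hab : a < b) :
    (Measure.pi fun _ : Fin n => unifIcc a b) =
      ((ENNReal.ofReal (b - a))⁻¹ ^ n) •
        (volume : Measure (Fin n → ℝ)).restrict (Set.univ.pi fun _ => Set.Icc a b) := by
  have hc : (ENNReal.ofReal (b - a))⁻¹ ≠ ⊤ := by
    simpa using hab
  have : IsFiniteMeasure (unifIcc a b) := by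
    unfold unifIcc
    exact Measure.smul_finite _ hc
  refine Measure.pi_eq (μ := fun _ : Fin n => unifIcc a b) fun s hs => ?_
  rw [Measure.smul_apply, Measure.restrict_apply (MeasurableSet.univ_pi hs), ← Set.pi_inter_distrib,
    volume_pi_pi]
  simp [unifIcc, Measure.restrict_apply (hs _), Finset.prod_mul_distrib]

/-- Integration along rays through the slice on which the first coordinate is `1`. -/
theorem lintegral_eq_lintegral_rays (m : ℕ) (H : (Fin (m + 1) → ℝ) → ENNReal) (hH : Measurable H)
    (h0 : ∀ y, y 0 ≤ 0 → H y = 0) :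
    ∫⁻ y, H y = ∫⁻ z : Fin m → ℝ, ∫⁻ r in Set.Ioi (0 : ℝ),
      ENNReal.ofReal (r ^ m) * H (r • Fin.cons 1 z) := by
  have hcons : Measurable fun p : ℝ × (Fin m → ℝ) => (Fin.cons p.1 p.2 : Fin (m + 1) → ℝ) := by
    refine measurable_pi_iff.2 fun i => ?_
    refine Fin.cases ?_ (fun j => ?_) i
    · simpa using measurable_fst
    · simp only [Fin.cons_succ]
      fun_prop
  have hsmul (r : ℝ) (z : Fin m → ℝ) :
      (r • Fin.cons 1 z : Fin (m + 1) → ℝ) = Fin.cons r (r • z) := by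
    ext i
    refine Fin.cases ?_ (fun j => ?_) i <;> simp
  have hscale (r : ℝ) (hr : 0 < r) : ∫⁻ z : Fin m → ℝ, H (Fin.cons r z) =
      ∫⁻ z : Fin m → ℝ, ENNReal.ofReal (r ^ m) * H (r • Fin.cons 1 z) := by
    simp_rw [hsmul]
    have hg : Measurable fun z : Fin m → ℝ => H (Fin.cons r z) :=
      hH.comp (hcons.comp (measurable_const.prodMk measurable_id))
    have hc : ∫⁻ z : Fin m → ℝ, ENNReal.ofReal (r ^ m) * H (Fin.cons r (r • z)) =
        ENNReal.ofReal (r ^ m) * ∫⁻ z : Fin m → ℝ, H (Fin.cons r (r • z)) :=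
      lintegral_const_mul _ (hg.comp (measurable_const_smul r))
    rw [hc]
    have hmap := Measure.map_addHaar_smul (volume : Measure (Fin m → ℝ)) hr.ne'
    have := lintegral_map (μ := volume) hg (measurable_const_smul r)
    rw [← this, hmap, lintegral_smul_measure, smul_eq_mul, ← mul_assoc,
      ← ENNReal.ofReal_mul (by positivity), Module.finrank_fin_fun, abs_of_pos (by positivity), mul_inv_cancel₀ (by positivity)]
    simp
  have hmp := (volume_preserving_piFinSuccAbove (fun _ : Fin (m + 1) => ℝ) 0).symm
  rw [← hmp.lintegral_comp hH, Measure.volume_eq_prod, lintegral_prod _ (by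
    exact (hH.comp hmp.measurable).aemeasurable)]
  have hins (r : ℝ) (z : Fin m → ℝ) :
      (MeasurableEquiv.piFinSuccAbove (fun _ : Fin (m + 1) => ℝ) 0).symm (r, z) = Fin.cons r z := by
    simp [MeasurableEquiv.piFinSuccAbove, Fin.insertNthEquiv]
  simp_rw [hins]
  rw [← setLIntegral_eq_of_support_subset (s := Set.Ioi 0)]
  · rw [setLIntegral_congr_fun measurableSet_Ioi fun r hr => hscale r hr]
    rw [lintegral_lintegral_swap]
    simp_rw [hsmul]
    refine Measurable.aemeasurable ?_
    refine Measurable.mul (by fun_prop) (hH.comp (hcons.comp (f := fun p : ℝ × (Fin m → ℝ) =>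
      (p.1, p.1 • p.2)) (by fun_prop)))
  · intro r hr
    by_contra hr'
    refine hr ?_
    simp [h0 _ (show (Fin.cons r _ : Fin (m + 1) → ℝ) 0 ≤ 0 by simpa using hr')]

theorem integral_log_deviation_eq_zero (m : ℕ) {A B t : ℝ} (hA : 0 < A) (hAB : A < B)
    (ht : t = Real.log B + Real.log (B / A) / ((B / A) ^ (m + 1) - 1) - 1 / ((m + 1 : ℕ) : ℝ)) :
    ∫ r in A..B, (t - Real.log r) * r ^ m = 0 := by
  have hB := hA.trans hAB
  have hpos : ∀ r ∈ Set.uIcc A B, 0 < r := fun r hr => by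
    rw [Set.uIcc_of_le hAB.le] at hr
    exact hA.trans_le hr.1
  have hcast : ((m + 1 : ℕ) : ℝ) = (m : ℝ) + 1 := by push_cast; ring
  have hm : (m : ℝ) + 1 ≠ 0 := by positivity
  rw [intervalIntegral.integral_eq_sub_of_hasDerivAt
    (f := fun r => r ^ (m + 1) / (m + 1) * (t - Real.log r + 1 / (m + 1)))]
  · have hpow : A ^ (m + 1) < B ^ (m + 1) := by gcongr
    have hne : B ^ (m + 1) - A ^ (m + 1) ≠ 0 := by linarith
    have hAm : A ^ (m + 1) ≠ 0 := by positivity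
    have h1 : (B / A) ^ (m + 1) - 1 = (B ^ (m + 1) - A ^ (m + 1)) / A ^ (m + 1) := by
      rw [div_pow]; field_simp
    rw [ht, h1, Real.log_div hB.ne' hA.ne', hcast]
    generalize B ^ (m + 1) = β at *
    generalize A ^ (m + 1) = α at *
    field_simp
    ring
  · intro r hr
    have hr0 := hpos r hr
    have h1 := ((hasDerivAt_pow (m + 1) r).div_const ((m : ℝ) + 1)).mul
      (((Real.hasDerivAt_log hr0.ne').const_sub t).add_const (1 / ((m : ℝ) + 1)))
    refine h1.congr_deriv ?_
    rw [hcast, Nat.add_sub_cancel]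
    field_simp
    ring
  · refine ContinuousOn.intervalIntegrable ?_
    exact (continuousOn_const.sub (Real.continuousOn_log.mono fun r hr => (hpos r hr).ne')).mul
      (by fun_prop)

theorem lintegral_sq_log_deviation_le (m : ℕ) {A B t : ℝ} (hA : 0 < A)
    (ht : t = Real.log B + Real.log (B / A) / ((B / A) ^ (m + 1) - 1) - 1 / ((m + 1 : ℕ) : ℝ))
    (s : ℝ) :
    ∫⁻ r in Set.Icc A B, ENNReal.ofReal (r ^ m) * ENNReal.ofReal ((t - Real.log r) ^ 2) ≤
      ∫⁻ r in Set.Icc A B, ENNReal.ofReal (r ^ m) * ENNReal.ofReal ((s - Real.log r) ^ 2) := by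
  rcases le_or_gt B A with hBA | hAB
  · rw [Measure.restrict_eq_zero.2 (by simp [hBA])]
    simp
  have hpos : ∀ r ∈ Set.Icc A B, 0 < r := fun r hr => hA.trans_le hr.1
  have hlog : ContinuousOn Real.log (Set.Icc A B) :=
    Real.continuousOn_log.mono fun r hr => (hpos r hr).ne'
  have hint (u : ℝ) : IntegrableOn (fun r => r ^ m * (u - Real.log r) ^ 2) (Set.Icc A B) :=
    ContinuousOn.integrableOn_Icc (by fun_prop)
  have key (u : ℝ) :
      ∫⁻ r in Set.Icc A B, ENNReal.ofReal (r ^ m) * ENNReal.ofReal ((u - Real.log r) ^ 2) =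
        ENNReal.ofReal (∫ r in Set.Icc A B, r ^ m * (u - Real.log r) ^ 2) := by
    rw [ofReal_integral_eq_lintegral_ofReal (hint u)]
    · refine setLIntegral_congr_fun measurableSet_Icc fun r hr => ?_
      have := hpos r hr
      rw [ENNReal.ofReal_mul (by positivity)]
    · refine (ae_restrict_iff' measurableSet_Icc).2 (ae_of_all _ fun r hr => ?_)
      have := hpos r hr
      simp only [Pi.zero_apply]
      positivity
  rw [key, key]
  refine ENNReal.ofReal_le_ofReal ?_
  have hdev : IntegrableOn (fun r => (t - Real.log r) * r ^ m) (Set.Icc A B) :=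
    ContinuousOn.integrableOn_Icc (by fun_prop)
  have hzero := integral_log_deviation_eq_zero m hA hAB ht
  rw [intervalIntegral.integral_of_le hAB.le, ← integral_Icc_eq_integral_Ioc] at hzero
  calc ∫ r in Set.Icc A B, r ^ m * (t - Real.log r) ^ 2
      = ∫ r in Set.Icc A B, (r ^ m * (t - Real.log r) ^ 2
          + 2 * (s - t) * ((t - Real.log r) * r ^ m)) := by
        rw [integral_add (hint t) (hdev.const_mul _), integral_const_mul, hzero]
        simp
    _ ≤ ∫ r in Set.Icc A B, r ^ m * (s - Real.log r) ^ 2 := by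
        refine setIntegral_mono_on ((hint t).add (hdev.const_mul _)) (hint s) measurableSet_Icc
          fun r hr => ?_
        have := hpos r hr
        nlinarith [mul_nonneg (pow_pos this m).le (sq_nonneg (s - t))]

theorem smul_mem_pi_Icc_iff {m : ℕ} {a b r : ℝ} {v : Fin (m + 1) → ℝ} (hv : ∀ i, 0 < v i)
    (hr : 0 < r) :
    r • v ∈ (Set.univ.pi fun _ : Fin (m + 1) => Set.Icc a b) ↔
      r ∈ Set.Icc (a / ⨅ i, v i) (b / ⨆ i, v i) := by
  obtain ⟨i, hi⟩ := exists_eq_ciInf_of_finite (f := v)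
  obtain ⟨j, hj⟩ := exists_eq_ciSup_of_finite (f := v)
  rw [Set.mem_Icc, div_le_iff₀ (hi ▸ hv i), le_div_iff₀ (hj ▸ hv j)]
  simp only [Set.mem_univ_pi, Pi.smul_apply, smul_eq_mul, Set.mem_Icc]
  constructor
  · intro h
    exact ⟨hi ▸ (h i).1, hj ▸ (h j).2⟩
  · rintro ⟨h1, h2⟩ l
    exact ⟨h1.trans (mul_le_mul_of_nonneg_left (ciInf_le (Finite.bddBelow_range v) l) hr.le),
      (mul_le_mul_of_nonneg_left (le_ciSup (Finite.bddAbove_range v) l) hr.le).trans h2⟩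

theorem psiSC_smul (n : ℕ) (k : ℝ) {c : ℝ} (hc : 0 < c) (y : Fin n → ℝ) :
    psiSC n k (c • y) = c * psiSC n k y := by
  simp only [psiSC, Pi.smul_apply, smul_eq_mul, ← Real.mul_iSup_of_nonneg hc.le,
    ← Real.mul_iInf_of_nonneg hc.le, mul_div_assoc, mul_div_mul_left _ _ hc.ne']
  ring

theorem measurable_psiSC (n : ℕ) (k : ℝ) : Measurable (psiSC n k) := by
  have h1 : Measurable fun y : Fin n → ℝ => ⨆ i, y i :=
    Measurable.iSup fun i => measurable_pi_apply i
  have h2 : Measurable fun y : Fin n → ℝ => ⨅ i, y i :=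
    Measurable.iInf fun i => measurable_pi_apply i
  unfold psiSC
  fun_prop

theorem psiSC_pos {m : ℕ} {k : ℝ} (hk : k ∈ Set.Ioo (0 : ℝ) 1) {y : Fin (m + 1) → ℝ}
    (hy : ∀ i, 0 < y i) : 0 < psiSC (m + 1) k y := by
  obtain ⟨j, hj⟩ := exists_eq_ciSup_of_finite (f := y)
  have h1 : 0 < ⨆ i, y i := hj ▸ hy j
  have h2 : 0 < 1 + k := by linarith [hk.1]
  unfold psiSC
  positivity

theorem log_sub_log_psiSC {m : ℕ} {k : ℝ} (hk : k ∈ Set.Ioo (0 : ℝ) 1) {θ : ℝ} (hθ : 0 < θ)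
    {v : Fin (m + 1) → ℝ} (hv : ∀ i, 0 < v i) {A B : ℝ} (hA : A = θ * (1 - k) / ⨅ i, v i)
    (hB : B = θ * (1 + k) / ⨆ i, v i) :
    Real.log θ - Real.log (psiSC (m + 1) k v) =
      Real.log B + Real.log (B / A) / ((B / A) ^ (m + 1) - 1) - 1 / ((m + 1 : ℕ) : ℝ) := by
  obtain ⟨i, hi⟩ := exists_eq_ciInf_of_finite (f := v)
  obtain ⟨j, hj⟩ := exists_eq_ciSup_of_finite (f := v)
  have hmin : 0 < ⨅ i, v i := hi ▸ hv i
  have hmax : 0 < ⨆ i, v i := hj ▸ hv j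
  have h1 : 0 < 1 - k := by linarith [hk.2]
  have h2 : 0 < 1 + k := by linarith [hk.1]
  have hratio : ((⨅ i, v i) / (1 - k)) / ((⨆ i, v i) / (1 + k)) = B / A := by
    rw [hA, hB]
    field_simp
  rw [psiSC, hratio, Real.log_mul (by positivity) (Real.exp_ne_zero _), Real.log_exp,
    Real.log_div hmax.ne' h2.ne']
  have hlogB : Real.log B = Real.log θ + Real.log (1 + k) - Real.log (⨆ i, v i) := by
    rw [hB, Real.log_div (by positivity) hmax.ne', Real.log_mul hθ.ne' h2.ne']
  rw [hlogB]
  ring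

/-- Along the ray through `v`, the risk integrand of an equivariant estimator depends on the
estimator only through its value at `v`. -/
theorem lintegral_ray_risk {m : ℕ} {a b θ : ℝ} (ha : 0 < a) {ψ : (Fin (m + 1) → ℝ) → ℝ}
    (hpos : ∀ y, (∀ i, 0 < y i) → 0 < ψ y)
    (hψ : ∀ c : ℝ, 0 < c → ∀ y, (∀ i, 0 < y i) → ψ (c • y) = c * ψ y)
    {v : Fin (m + 1) → ℝ} (hv : ∀ i, 0 < v i) :
    ∫⁻ r in Set.Ioi (0 : ℝ), ENNReal.ofReal (r ^ m) *
        (Set.univ.pi fun _ : Fin (m + 1) => Set.Icc a b).indicator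
          (fun y => ENNReal.ofReal ((Real.log θ - Real.log (ψ y)) ^ 2)) (r • v) =
      ∫⁻ r in Set.Icc (a / ⨅ i, v i) (b / ⨆ i, v i), ENNReal.ofReal (r ^ m) *
        ENNReal.ofReal ((Real.log θ - Real.log (ψ v) - Real.log r) ^ 2) := by
  obtain ⟨i, hi⟩ := exists_eq_ciInf_of_finite (f := v)
  have hmin : 0 < ⨅ i, v i := hi ▸ hv i
  have hsub : Set.Icc (a / ⨅ i, v i) (b / ⨆ i, v i) ⊆ Set.Ioi 0 := fun r hr =>
    (div_pos ha hmin).trans_le hr.1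
  rw [← lintegral_indicator measurableSet_Ioi, ← lintegral_indicator measurableSet_Icc]
  refine lintegral_congr fun r => ?_
  by_cases hr : 0 < r
  · rw [Set.indicator_of_mem (Set.mem_Ioi.2 hr)]
    by_cases hmem : r ∈ Set.Icc (a / ⨅ i, v i) (b / ⨆ i, v i)
    · rw [Set.indicator_of_mem hmem, Set.indicator_of_mem ((smul_mem_pi_Icc_iff hv hr).2 hmem),
        hψ r hr v hv, Real.log_mul hr.ne' (hpos v hv).ne']
      congr 3
      ring
    · rw [Set.indicator_of_notMem hmem,
        Set.indicator_of_notMem (fun h => hmem ((smul_mem_pi_Icc_iff hv hr).1 h)), mul_zero]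
  · rw [Set.indicator_of_notMem (by simpa using hr), Set.indicator_of_notMem fun h => hr (hsub h)]

/-- `ψ_SC = θ̂_SC` is scale equivariant and uniformly minimizes the
squared logarithmic risk among scale-equivariant estimators of the scale parameter `θ`
of the scaled uniform model. -/
theorem stmt_18 (n : ℕ) (hn : 2 ≤ n) (k : ℝ) (hk : k ∈ Set.Ioo (0:ℝ) 1) :
    (∀ c : ℝ, 0 < c → ∀ y : Fin n → ℝ, (∀ i, 0 < y i) →
      psiSC n k (c • y) = c * psiSC n k y) ∧
    (∀ ψ : (Fin n → ℝ) → ℝ, Measurable ψ →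
      (∀ y : Fin n → ℝ, (∀ i, 0 < y i) → 0 < ψ y) →
      (∀ c : ℝ, 0 < c → ∀ y : Fin n → ℝ, (∀ i, 0 < y i) → ψ (c • y) = c * ψ y) →
      ∀ θ : ℝ, 0 < θ →
        (∫⁻ y : Fin n → ℝ, ENNReal.ofReal ((Real.log θ - Real.log (psiSC n k y)) ^ 2)
            ∂(Measure.pi fun _ : Fin n => unifIcc (θ * (1 - k)) (θ * (1 + k))))
          ≤ ∫⁻ y : Fin n → ℝ, ENNReal.ofReal ((Real.log θ - Real.log (ψ y)) ^ 2)
            ∂(Measure.pi fun _ : Fin n => unifIcc (θ * (1 - k)) (θ * (1 + k)))) := by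
  obtain ⟨m, rfl⟩ : ∃ m, n = m + 1 := ⟨n - 1, by omega⟩
  refine ⟨fun c hc y _ => psiSC_smul _ k hc y, fun ψ hψm hψpos hψ θ hθ => ?_⟩
  have ha : 0 < θ * (1 - k) := mul_pos hθ (by linarith [hk.2])
  have hab : θ * (1 - k) < θ * (1 + k) := by gcongr; linarith [hk.1]
  have hbox : MeasurableSet (Set.univ.pi fun _ : Fin (m + 1) =>
      Set.Icc (θ * (1 - k)) (θ * (1 + k))) := MeasurableSet.univ_pi fun _ => measurableSet_Icc
  rw [pi_unifIcc _ _ _ hab, lintegral_smul_measure, lintegral_smul_measure]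
  refine mul_le_mul_right ?_ _
  rw [← lintegral_indicator hbox, ← lintegral_indicator hbox,
    lintegral_eq_lintegral_rays, lintegral_eq_lintegral_rays]
  · refine lintegral_mono fun z => ?_
    by_cases hv : ∀ i, 0 < (Fin.cons 1 z : Fin (m + 1) → ℝ) i
    · simp only
      rw [lintegral_ray_risk ha hψpos hψ hv, lintegral_ray_risk ha (fun y hy => psiSC_pos hk hy)
        (fun c hc y _ => psiSC_smul _ k hc y) hv]
      refine lintegral_sq_log_deviation_le m ?_ (log_sub_log_psiSC hk hθ hv rfl rfl) _
      obtain ⟨i, hi⟩ := exists_eq_ciInf_of_finite (f := (Fin.cons 1 z : Fin (m + 1) → ℝ))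
      exact div_pos ha (hi ▸ hv i)
    · push Not at hv
      obtain ⟨i, hi⟩ := hv
      refine setLIntegral_mono' measurableSet_Ioi fun r hr => ?_
      rw [Set.indicator_of_notMem, mul_zero]
      · exact zero_le
      · intro h
        have h1 := (h i (Set.mem_univ i)).1
        simp only [Pi.smul_apply, smul_eq_mul] at h1
        linarith [mul_nonpos_of_nonneg_of_nonpos (le_of_lt hr) hi]
  · exact Measurable.indicator (by fun_prop) hbox
  · intro y hy
    exact Set.indicator_of_notMem (fun h => by linarith [(h 0 (Set.mem_univ 0)).1]) _
  · have := measurable_psiSC (m + 1) k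
    exact Measurable.indicator (by fun_prop) hbox
  · intro y hy
    exact Set.indicator_of_notMem (fun h => by linarith [(h 0 (Set.mem_univ 0)).1]) _
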